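/- Let $G$ be a DAG with $n$ vertices and $e$ edges for which the shortest trek map $\psi_G$ is well defined. Then the Krull dimension of the quotient ring $\mathbb{C}[\sigma_{ij} : 1 \le i \le j \le n]/ST_G$, where $ST_G = \ker \psi_G$, equals $n + e$. -/

import Mathlib

open MvPolynomial

/-- A (simple) trek in a directed graph with adjacency `Adj`: a pair of directed
paths from a common source (top) vertex down to `i` and down to `j`, with no
repeated vertices overall (i.e. a simple colliderless path between `i` and `j`). -/
structure Trek {V : Type*} (Adj : V → V → Prop) (i j : V) where
  left : List V
  right : List V
  left_ne : left ≠ []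
  right_ne : right ≠ []
  same_top : left.head? = right.head?
  chain_left : left.Chain' Adj
  chain_right : right.Chain' Adj
  last_left : left.getLast? = some i
  last_right : right.getLast? = some j
  nodup : (left ++ right.tail).Nodup

namespace Trek

variable {V : Type*} {Adj : V → V → Prop} {i j : V}

/-- The topmost (source) vertex of a trek. -/
def top (t : Trek Adj i j) : V := t.left.head t.left_ne

/-- The list of directed edges used by a trek. -/
def edges (t : Trek Adj i j) : List (V × V) :=
  t.left.zip t.left.tail ++ t.right.zip t.right.tail

end Trek

/-- A trek is shortest if no trek between the same endpoints has fewer edges. -/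
def IsShortestTrek {V : Type*} {Adj : V → V → Prop} {i j : V} (t : Trek Adj i j) : Prop :=
  ∀ t' : Trek Adj i j, t.edges.length ≤ t'.edges.length

/-- Between any two vertices there is a unique shortest trek (whenever some trek
exists); this is the condition for the shortest trek map to be well defined. -/
def ShortestTreksUnique {V : Type*} (Adj : V → V → Prop) : Prop :=
  ∀ (i j : V) (t t' : Trek Adj i j), IsShortestTrek t → IsShortestTrek t' →
    t'.left = t.left ∧ t'.right = t.right

/-- A DAG on vertex set `Fin n`, with all edges pointing from a smaller vertex to a
larger one (vertices are numerically ordered, which guarantees acyclicity). -/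
structure DAG (n : ℕ) where
  E : Finset (Fin n × Fin n)
  increasing : ∀ e ∈ E, e.1 < e.2

def DAG.Adj {n : ℕ} (G : DAG n) (i j : Fin n) : Prop := (i, j) ∈ G.E

/-- Index type for the indeterminates `σ_{ij}`, `1 ≤ i ≤ j ≤ n`. -/
abbrev SymIdx (n : ℕ) := {p : Fin n × Fin n // p.1 ≤ p.2}

/-- The monomial `a_{top t} * ∏_{(k,l) ∈ t} λ_{kl}` associated to a trek `t`, in the
polynomial ring `ℂ[a_i, λ_{kl}]` (where `a_i = X (Sum.inl i)`, `λ_{kl} = X (Sum.inr (k,l))`). -/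
noncomputable def trekMonomial {n : ℕ} {Adj : Fin n → Fin n → Prop} {i j : Fin n}
    (t : Trek Adj i j) : MvPolynomial (Fin n ⊕ Fin n × Fin n) ℂ :=
  X (Sum.inl t.top) *
    (t.edges.map fun e => (X (Sum.inr e) : MvPolynomial (Fin n ⊕ Fin n × Fin n) ℂ)).prod

/-- `ψ` is the shortest trek map of `G`: it sends `σ_{ij}` to `0` when there is no trek
between `i` and `j`, and to the monomial of the (unique) shortest trek otherwise
(for `i = j` the unique trek is trivial and the monomial is `a_i`). -/
def IsShortestTrekMap {n : ℕ} (G : DAG n)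
    (ψ : MvPolynomial (SymIdx n) ℂ →ₐ[ℂ] MvPolynomial (Fin n ⊕ Fin n × Fin n) ℂ) : Prop :=
  ∀ p : SymIdx n,
    (IsEmpty (Trek G.Adj p.1.1 p.1.2) → ψ (X p) = 0) ∧
    (∀ t : Trek G.Adj p.1.1 p.1.2, IsShortestTrek t → ψ (X p) = trekMonomial t)

/-- Krull dimension is invariant under integral ring extensions. -/
theorem ringKrullDim_eq_of_isIntegral {R S : Type*} [CommRing R] [CommRing S] [Algebra R S]
    [Algebra.IsIntegral R S] [FaithfulSMul R S] : ringKrullDim R = ringKrullDim S := by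
  apply le_antisymm
  · refine iSup_le fun l => ?_
    obtain ⟨Q, hQ⟩ := Algebra.IsIntegral.comap_surjective (R := R) (S := S) l.head
    have : Q.asIdeal.LiesOver l.head.asIdeal := ⟨by rw [← hQ]; rfl⟩
    obtain ⟨L, hL, -⟩ := Ideal.exists_ltSeries_of_hasGoingUp l Q.asIdeal
    rw [← hL]
    exact Order.LTSeries.length_le_krullDim L
  · refine Order.krullDim_le_of_strictMono (PrimeSpectrum.comap (algebraMap R S)) fun P Q h => ?_
    exact Ideal.IsIntegral.comap_lt_comap (R := R) (I := P.asIdeal) (J := Q.asIdeal) h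

/-- The Krull dimension of a finitely generated domain over a field is its transcendence degree. -/
theorem ringKrullDim_eq_of_trdeg_eq {k : Type*} {A : Type*} [Field k] [CommRing A] [IsDomain A]
    [Algebra k A] [Algebra.FiniteType k A] {d : ℕ} (hd : Algebra.trdeg k A = d) :
    ringKrullDim A = d := by
  obtain ⟨s, g, hinj, hint⟩ := exists_integral_inj_algHom_of_fg k A
  algebraize [g.toRingHom]
  have hinj' : Function.Injective (algebraMap (MvPolynomial (Fin s) k) A) := hinj
  have : FaithfulSMul (MvPolynomial (Fin s) k) A :=
    (faithfulSMul_iff_algebraMap_injective _ _).mpr hinj'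
  have : IsScalarTower k (MvPolynomial (Fin s) k) A :=
    IsScalarTower.of_algebraMap_eq fun x => (g.commutes x).symm
  have h := lift_trdeg_add_eq k (MvPolynomial (Fin s) k) A
  rw [trdeg_eq_zero (R := MvPolynomial (Fin s) k), hd, MvPolynomial.trdeg_of_isDomain] at h
  have hs : s = d := by simpa using h
  rw [← ringKrullDim_eq_of_isIntegral (R := MvPolynomial (Fin s) k) (S := A)]
  simp [hs]

theorem List.IsChain.rel_of_mem_zip_tail {α : Type*} {r : α → α → Prop} :
    ∀ {l : List α}, l.IsChain r → ∀ {e : α × α}, e ∈ l.zip l.tail → r e.1 e.2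
  | [], _, _, he => by simp at he
  | [_], _, _, he => by simp at he
  | a :: b :: l, h, e, he => by
    rw [List.isChain_cons_cons] at h
    simp only [List.tail_cons, List.zip_cons_cons, List.mem_cons] at he
    rcases he with rfl | he
    · exact h.1
    · exact h.2.rel_of_mem_zip_tail he

theorem List.exists_eq_singleton_of_zip_tail_eq_nil {α : Type*} {l : List α} (hl : l ≠ [])
    (h : l.zip l.tail = []) : ∃ a, l = [a] := by
  match l with
  | [] => exact absurd rfl hl
  | [a] => exact ⟨a, rfl⟩
  | a :: b :: l => simp at h

namespace Trek

variable {V : Type*} {Adj : V → V → Prop} {i j : V}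

theorem adj_of_mem_edges (t : Trek Adj i j) {e : V × V} (he : e ∈ t.edges) : Adj e.1 e.2 := by
  rcases List.mem_append.mp he with he | he
  · exact List.IsChain.rel_of_mem_zip_tail t.chain_left he
  · exact List.IsChain.rel_of_mem_zip_tail t.chain_right he

theorem eq_of_edges_eq_nil (t : Trek Adj i j) (h : t.edges = []) : i = j := by
  obtain ⟨h₁, h₂⟩ := List.append_eq_nil_iff.mp h
  obtain ⟨a, ha⟩ := List.exists_eq_singleton_of_zip_tail_eq_nil t.left_ne h₁
  obtain ⟨b, hb⟩ := List.exists_eq_singleton_of_zip_tail_eq_nil t.right_ne h₂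
  have h₃ := t.same_top
  have h₄ := t.last_left
  have h₅ := t.last_right
  simp_all

/-- The trek without edges from a vertex to itself. -/
def refl (Adj : V → V → Prop) (i : V) : Trek Adj i i where
  left := [i]
  right := [i]
  left_ne := by simp
  right_ne := by simp
  same_top := rfl
  chain_left := List.isChain_singleton i
  chain_right := List.isChain_singleton i
  last_left := rfl
  last_right := rfl
  nodup := by simp

/-- The trek consisting of a single edge. -/
def ofAdj (h : Adj i j) (hne : i ≠ j) : Trek Adj i j where
  left := [i]
  right := [i, j]
  left_ne := by simp
  right_ne := by simp
  same_top := rfl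
  chain_left := List.isChain_singleton i
  chain_right := List.isChain_pair.mpr h
  last_left := rfl
  last_right := rfl
  nodup := by simpa using hne

theorem isShortestTrek_refl (Adj : V → V → Prop) (i : V) : IsShortestTrek (refl Adj i) :=
  fun _ => Nat.zero_le _

theorem isShortestTrek_ofAdj (h : Adj i j) (hne : i ≠ j) : IsShortestTrek (ofAdj h hne) :=
  fun t => List.length_pos_iff.mpr fun ht => hne (t.eq_of_edges_eq_nil ht)

theorem exists_isShortestTrek [Nonempty (Trek Adj i j)] : ∃ t : Trek Adj i j, IsShortestTrek t :=
  ⟨Function.argmin fun t : Trek Adj i j => t.edges.length,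
    fun t => Function.argmin_le (fun t : Trek Adj i j => t.edges.length) t⟩

end Trek

section ShortestTrekMap

variable {n : ℕ} {G : DAG n}

/-- The inclusion of the indeterminates `a_i` and `λ_e`, for `e` an edge of `G`, into all
indeterminates. -/
def DAG.varEmb (G : DAG n) : Fin n ⊕ G.E → Fin n ⊕ Fin n × Fin n :=
  Sum.map id Subtype.val

theorem DAG.varEmb_injective (G : DAG n) : Function.Injective G.varEmb :=
  Sum.map_injective.mpr ⟨Function.injective_id, Subtype.val_injective⟩

theorem trekMonomial_mem_range_rename {i j : Fin n} (t : Trek G.Adj i j) :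
    trekMonomial t ∈ (rename (R := ℂ) G.varEmb).range := by
  refine mul_mem ⟨X (Sum.inl t.top), by simp [DAG.varEmb]⟩ (list_prod_mem fun x hx => ?_)
  obtain ⟨e, he, rfl⟩ := List.mem_map.mp hx
  exact ⟨X (Sum.inr ⟨e, t.adj_of_mem_edges he⟩), by simp [DAG.varEmb]⟩

/-- The monomials of the treks with at most one edge: `a_i` for a vertex `i`, and `a_k λ_{kl}` for
an edge `(k, l)`. -/
noncomputable def DAG.shortMonomial (G : DAG n) :
    Fin n ⊕ G.E → MvPolynomial (Fin n ⊕ Fin n × Fin n) ℂ :=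
  Sum.elim (fun i => X (Sum.inl i)) fun e => X (Sum.inl e.1.1) * X (Sum.inr e.1)

theorem DAG.algebraicIndependent_shortMonomial (G : DAG n) :
    AlgebraicIndependent ℂ G.shortMonomial := by
  let B := MvPolynomial (Fin n ⊕ Fin n × Fin n) ℂ
  let K := FractionRing B
  let x : Fin n ⊕ Fin n × Fin n → K := fun v => algebraMap B K (X v)
  let φ : B →ₐ[ℂ] K := aeval (Sum.elim (fun i => x (Sum.inl i))
    fun e => x (Sum.inr e) / x (Sum.inl e.1))
  have hx : ∀ v, x v ≠ 0 := fun v =>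
    (map_ne_zero_iff _ (IsFractionRing.injective B K)).mpr (X_ne_zero v)
  have hind : AlgebraicIndependent ℂ x :=
    (algebraicIndependent_X (Fin n ⊕ Fin n × Fin n) ℂ).map' (f := IsScalarTower.toAlgHom ℂ B K)
      (IsFractionRing.injective B K)
  refine .of_comp φ ?_
  convert hind.comp G.varEmb G.varEmb_injective using 1
  funext v
  rcases v with i | e
  · simp [φ, shortMonomial, varEmb]
  · simp [φ, shortMonomial, varEmb, mul_div_cancel₀ _ (hx _)]

variable {ψ : MvPolynomial (SymIdx n) ℂ →ₐ[ℂ] MvPolynomial (Fin n ⊕ Fin n × Fin n) ℂ}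

theorem IsShortestTrekMap.range_le (hψ : IsShortestTrekMap G ψ) :
    ψ.range ≤ (rename (R := ℂ) G.varEmb).range := by
  rw [← Algebra.map_top, ← adjoin_range_X, AlgHom.map_adjoin, Algebra.adjoin_le_iff]
  rintro _ ⟨_, ⟨p, rfl⟩, rfl⟩
  rcases isEmpty_or_nonempty (Trek G.Adj p.1.1 p.1.2) with h | h
  · simpa [(hψ p).1 h] using ⟨0, map_zero _⟩
  · obtain ⟨t, ht⟩ := Trek.exists_isShortestTrek (Adj := G.Adj) (i := p.1.1) (j := p.1.2)
    simpa [(hψ p).2 t ht] using trekMonomial_mem_range_rename t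

theorem IsShortestTrekMap.shortMonomial_mem_range (hψ : IsShortestTrekMap G ψ)
    (v : Fin n ⊕ G.E) : G.shortMonomial v ∈ ψ.range := by
  rcases v with i | ⟨⟨i, j⟩, he⟩
  · exact ⟨X ⟨(i, i), le_rfl⟩, ((hψ _).2 _ (Trek.isShortestTrek_refl G.Adj i)).trans
      (by simp [trekMonomial, Trek.refl, Trek.edges, Trek.top, DAG.shortMonomial])⟩
  · have hij : i < j := G.increasing _ he
    exact ⟨X ⟨(i, j), hij.le⟩, ((hψ _).2 _ (Trek.isShortestTrek_ofAdj he hij.ne)).trans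
      (by simp [trekMonomial, Trek.ofAdj, Trek.edges, Trek.top, DAG.shortMonomial])⟩

theorem IsShortestTrekMap.trdeg_range (hψ : IsShortestTrekMap G ψ) :
    Algebra.trdeg ℂ ψ.range = (n + G.E.card : ℕ) := by
  apply le_antisymm
  · refine (trdeg_le_of_injective (Subalgebra.inclusion hψ.range_le)
      (Subalgebra.inclusion_injective _)).trans_eq ?_
    rw [← (AlgEquiv.ofInjective _ (rename_injective (R := ℂ) _ G.varEmb_injective)).trdeg_eq,
      MvPolynomial.trdeg_of_isDomain]
    simp
  · have h : AlgebraicIndependent ℂ fun v =>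
        (⟨G.shortMonomial v, hψ.shortMonomial_mem_range v⟩ : ψ.range) :=
      .of_comp ψ.range.val G.algebraicIndependent_shortMonomial
    simpa using h.cardinalMk_le_trdeg

end ShortestTrekMap

theorem stmt4 (n : ℕ) (G : DAG n) (hst : ShortestTreksUnique G.Adj)
    (ψ : MvPolynomial (SymIdx n) ℂ →ₐ[ℂ] MvPolynomial (Fin n ⊕ Fin n × Fin n) ℂ)
    (hψ : IsShortestTrekMap G ψ) :
    ringKrullDim (MvPolynomial (SymIdx n) ℂ ⧸ RingHom.ker ψ.toRingHom) =
      ((n + G.E.card : ℕ) : WithBot ℕ∞) := by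
  have : Algebra.FiniteType ℂ ψ.range :=
    .of_surjective ψ.rangeRestrict ψ.rangeRestrict_surjective
  exact (ringKrullDim_eq_of_ringEquiv (Ideal.quotientKerEquivRange ψ).toRingEquiv).trans
    (ringKrullDim_eq_of_trdeg_eq hψ.trdeg_range)
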